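/- Let f, g, h₁, h₂ : ℝ^{3n} → ℝ be smooth functions satisfying (df ∧ dg)^{♯♭} = df ∧ dg and (dh₁ ∧ dh₂)^{♯♭} = dh₁ ∧ dh₂ pointwise. Then the Nambu–Poisson bracket of the 2-form fields dh₁ ∧ dh₂ and df ∧ dg satisfies {dh₁ ∧ dh₂, df ∧ dg} = d{f, h₁, h₂} ∧ dg + df ∧ d{g, h₁, h₂}. -/

import Mathlib

noncomputable section

/-- The model space `ℝ^{3n}`, realized as `Fin n × Fin 3 → ℝ`; the index `(i, p)`
corresponds to the coordinate `x_{3i+p+1}`. -/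
abbrev V (n : ℕ) : Type := Fin n × Fin 3 → ℝ

/-- The standard basis vector `e_{(i,p)}` of `ℝ^{3n}`. -/
def stdVec (n : ℕ) (i : Fin n) (p : Fin 3) : V n := Pi.single (i, p) 1

/-- The Levi-Civita symbol `ε_{plm}` on three indices. -/
def eps (p l m : Fin 3) : ℝ :=
  Matrix.det (Matrix.of ![(Pi.single p 1 : Fin 3 → ℝ), Pi.single l 1, Pi.single m 1])

/-- The standard Nambu 3-form `ω = Σ_{i=0}^{n-1} dx_{3i+1} ∧ dx_{3i+2} ∧ dx_{3i+3}`
on `ℝ^{3n}`, evaluated on three vectors. -/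
def omega3 (n : ℕ) (u v w : V n) : ℝ :=
  ∑ i : Fin n,
    Matrix.det (Matrix.of ![(fun p => u (i, p)), (fun p => v (i, p)), (fun p => w (i, p))])

/-- `X^♭ = i_X ω`: the 2-form obtained by contracting the standard Nambu 3-form with `X`. -/
def flat (n : ℕ) (X : V n) : V n → V n → ℝ := fun u v => omega3 n X u v

/-- `α^♯`: the vector associated to a 2-form `α`, with components
`(α^♯)_{3i+p} = (1/2) Σ_{l,m} ε_{plm} α_{3i+l, 3i+m}`. -/
def sharp (n : ℕ) (α : V n → V n → ℝ) : V n :=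
  fun q => (1 / 2) * ∑ l : Fin 3, ∑ m : Fin 3,
    eps q.2 l m * α (stdVec n q.1 l) (stdVec n q.1 m)

/-- A smooth 2-form field on `ℝ^{3n}`: at each point it is an alternating bilinear form,
depending smoothly on the point. -/
structure IsSmooth2FormField (n : ℕ) (α : V n → V n → V n → ℝ) : Prop where
  add_left : ∀ (x u u' v : V n), α x (u + u') v = α x u v + α x u' v
  smul_left : ∀ (x : V n) (c : ℝ) (u v : V n), α x (c • u) v = c * α x u v
  add_right : ∀ (x u v v' : V n), α x u (v + v') = α x u v + α x u v'
  smul_right : ∀ (x : V n) (c : ℝ) (u v : V n), α x u (c • v) = c * α x u v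
  alt : ∀ x u : V n, α x u u = 0
  smooth : ∀ u v : V n, ContDiff ℝ (⊤ : ℕ∞) (fun x => α x u v)

/-- The vector field `α^♯` associated to a 2-form field `α`, obtained by applying `♯`
pointwise. -/
def sharpField (n : ℕ) (α : V n → V n → V n → ℝ) : V n → V n := fun x => sharp n (α x)

/-- The Lie bracket of vector fields on `ℝ^{3n}`: `[X, Y](x) = DY(x)·X(x) - DX(x)·Y(x)`. -/
def lieBracketVF (n : ℕ) (X Y : V n → V n) : V n → V n :=
  fun x => fderiv ℝ Y x (X x) - fderiv ℝ X x (Y x)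

/-- The Nambu–Poisson bracket of 2-form fields: `{α, β} = ([α^♯, β^♯])^♭`. -/
def npBracket (n : ℕ) (α β : V n → V n → V n → ℝ) : V n → V n → V n → ℝ :=
  fun x u v => omega3 n (lieBracketVF n (sharpField n α) (sharpField n β) x) u v

/-- The 2-form field `df ∧ dg` of two functions `f, g : ℝ^{3n} → ℝ`. -/
def wedge11 (n : ℕ) (f g : V n → ℝ) : V n → V n → V n → ℝ :=
  fun x u v => fderiv ℝ f x u * fderiv ℝ g x v - fderiv ℝ f x v * fderiv ℝ g x u

/-- The Nambu bracket of three functions: `{f, g, h} = df((dg ∧ dh)^♯)`. -/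
def nambuBracket3 (n : ℕ) (f g h : V n → ℝ) : V n → ℝ :=
  fun x => fderiv ℝ f x (sharpField n (wedge11 n g h) x)

lemma om_add (n : ℕ) (a b u v : V n) :
    omega3 n (a + b) u v = omega3 n a u v + omega3 n b u v := by
  simp only [omega3, Matrix.det_fin_three, ← Finset.sum_add_distrib]
  refine Finset.sum_congr rfl fun i _ => ?_
  simp
  ring

lemma om_smul (n : ℕ) (c : ℝ) (a u v : V n) :
    omega3 n (c • a) u v = c * omega3 n a u v := by
  simp only [omega3, Matrix.det_fin_three, Finset.mul_sum]
  refine Finset.sum_congr rfl fun i _ => ?_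
  simp
  ring

lemma om_cyc (n : ℕ) (a u v : V n) : omega3 n a u v = omega3 n u v a := by
  simp only [omega3, Matrix.det_fin_three]
  refine Finset.sum_congr rfl fun i _ => ?_
  simp
  ring

def omL (n : ℕ) (u v : V n) : V n →L[ℝ] ℝ :=
  LinearMap.toContinuousLinearMap
    { toFun := fun a => omega3 n a u v
      map_add' := fun a b => om_add n a b u v
      map_smul' := fun c a => om_smul n c a u v }

lemma omL_apply (n : ℕ) (u v a : V n) : omL n u v a = omega3 n a u v := rfl

lemma two_le : (2 : WithTop ℕ∞) ≤ ((⊤ : ℕ∞) : WithTop ℕ∞) :=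
  WithTop.coe_le_coe.2 (le_top : (2 : ℕ∞) ≤ ⊤)

lemma diff_fd {n : ℕ} {f : V n → ℝ} (hf : ContDiff ℝ (⊤ : ℕ∞) f) :
    Differentiable ℝ (fderiv ℝ f) :=
  (hf.fderiv_right (m := 1) (by rw [one_add_one_eq_two]; exact two_le)).differentiable (by simp)

lemma sym_fd {n : ℕ} {f : V n → ℝ} (hf : ContDiff ℝ (⊤ : ℕ∞) f) (x u v : V n) :
    fderiv ℝ (fderiv ℝ f) x u v = fderiv ℝ (fderiv ℝ f) x v u :=
  (hf.contDiffAt.isSymmSndFDerivAt (by simpa using two_le)) u v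

lemma diff_sharp {n : ℕ} {f g : V n → ℝ} (hf : ContDiff ℝ (⊤ : ℕ∞) f)
    (hg : ContDiff ℝ (⊤ : ℕ∞) g) : Differentiable ℝ (sharpField n (wedge11 n f g)) := by
  have h1 := diff_fd hf
  have h2 := diff_fd hg
  rw [differentiable_pi]
  intro q
  simp only [sharpField, sharp, wedge11]
  fun_prop

lemma has_fd_apply {n : ℕ} {f : V n → ℝ} (hf : ContDiff ℝ (⊤ : ℕ∞) f) (x u : V n) :
    HasFDerivAt (fun y => fderiv ℝ f y u) ((fderiv ℝ (fderiv ℝ f) x).flip u) x := by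
  have h := (diff_fd hf x).hasFDerivAt.clm_apply (hasFDerivAt_const u x)
  simpa using h

/-- differentiating `ω(Y,u,v) = df ∧ dg (u,v)` -/
lemma key {n : ℕ} {f g : V n → ℝ} (hf : ContDiff ℝ (⊤ : ℕ∞) f)
    (hg : ContDiff ℝ (⊤ : ℕ∞) g)
    (hfg : ∀ x u v : V n,
      flat n (sharpField n (wedge11 n f g) x) u v = wedge11 n f g x u v) (x w u v : V n) :
    omega3 n (fderiv ℝ (sharpField n (wedge11 n f g)) x w) u v =
      fderiv ℝ (fderiv ℝ f) x w u * fderiv ℝ g x v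
      + fderiv ℝ f x u * fderiv ℝ (fderiv ℝ g) x w v
      - fderiv ℝ (fderiv ℝ f) x w v * fderiv ℝ g x u
      - fderiv ℝ f x v * fderiv ℝ (fderiv ℝ g) x w u := by
  have hL := (omL n u v).hasFDerivAt.comp x (diff_sharp hf hg x).hasFDerivAt
  have hR := ((has_fd_apply hf x u).mul (has_fd_apply hg x v)).sub
    ((has_fd_apply hf x v).mul (has_fd_apply hg x u))
  have e : (omL n u v) ∘ (sharpField n (wedge11 n f g)) =
      (fun y => fderiv ℝ f y u) * (fun y => fderiv ℝ g y v)
        - (fun y => fderiv ℝ f y v) * (fun y => fderiv ℝ g y u) := by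
    funext y
    exact hfg y u v
  rw [e] at hL
  have := congrArg (fun L => L w) (hL.unique hR)
  simp [omL_apply] at this
  rw [this]
  ring

lemma fd_nambu {n : ℕ} {f g h : V n → ℝ} (hf : ContDiff ℝ (⊤ : ℕ∞) f)
    (hg : ContDiff ℝ (⊤ : ℕ∞) g) (hh : ContDiff ℝ (⊤ : ℕ∞) h) (x u : V n) :
    fderiv ℝ (nambuBracket3 n f g h) x u =
      fderiv ℝ (fderiv ℝ f) x u (sharpField n (wedge11 n g h) x)
      + fderiv ℝ f x (fderiv ℝ (sharpField n (wedge11 n g h)) x u) := by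
  have h := (diff_fd hf x).hasFDerivAt.clm_apply (diff_sharp hg hh x).hasFDerivAt
  have h2 : fderiv ℝ (nambuBracket3 n f g _) x = _ := h.fderiv
  rw [h2]
  simp [add_comm]

/-- Let `f, g, h₁, h₂` be smooth functions on `ℝ^{3n}` with
`(df ∧ dg)^{♯♭} = df ∧ dg` and `(dh₁ ∧ dh₂)^{♯♭} = dh₁ ∧ dh₂`. Then
`{dh₁ ∧ dh₂, df ∧ dg} = d{f, h₁, h₂} ∧ dg + df ∧ d{g, h₁, h₂}`. -/
theorem npBracket_of_wedges (n : ℕ)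
    (f g h₁ h₂ : V n → ℝ)
    (hf : ContDiff ℝ (⊤ : ℕ∞) f) (hg : ContDiff ℝ (⊤ : ℕ∞) g)
    (hh₁ : ContDiff ℝ (⊤ : ℕ∞) h₁) (hh₂ : ContDiff ℝ (⊤ : ℕ∞) h₂)
    (hfg : ∀ x u v : V n,
      flat n (sharpField n (wedge11 n f g) x) u v = wedge11 n f g x u v)
    (hh : ∀ x u v : V n,
      flat n (sharpField n (wedge11 n h₁ h₂) x) u v = wedge11 n h₁ h₂ x u v) :
    ∀ x u v : V n,
      npBracket n (wedge11 n h₁ h₂) (wedge11 n f g) x u v =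
        wedge11 n (nambuBracket3 n f h₁ h₂) g x u v +
          wedge11 n f (nambuBracket3 n g h₁ h₂) x u v := by
  intro x u v
  have k1 := key hf hg hfg x (sharpField n (wedge11 n h₁ h₂) x) u v
  have c1 := key hh₁ hh₂ hh x (sharpField n (wedge11 n f g) x) u v
  have c2 := key hh₁ hh₂ hh x u v (sharpField n (wedge11 n f g) x)
  have c3 := key hh₁ hh₂ hh x v (sharpField n (wedge11 n f g) x) u
  have b1 := hfg x (fderiv ℝ (sharpField n (wedge11 n h₁ h₂)) x u) v
  have b2 := hfg x u (fderiv ℝ (sharpField n (wedge11 n h₁ h₂)) x v)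
  simp only [flat] at b1 b2
  rw [om_cyc] at b1
  rw [om_cyc, om_cyc] at b2
  have e : npBracket n (wedge11 n h₁ h₂) (wedge11 n f g) x u v =
      omega3 n (fderiv ℝ (sharpField n (wedge11 n f g)) x (sharpField n (wedge11 n h₁ h₂) x)) u v
      - omega3 n (fderiv ℝ (sharpField n (wedge11 n h₁ h₂)) x
          (sharpField n (wedge11 n f g) x)) u v :=
    (omL n u v).map_sub _ _
  rw [e]
  rw [b1] at c2
  rw [b2] at c3
  simp only [wedge11, fd_nambu hf hh₁ hh₂, fd_nambu hg hh₁ hh₂] at *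
  generalize sharpField n (wedge11 n f g) x = Y at *
  generalize sharpField n (wedge11 n h₁ h₂) x = X at *
  rw [sym_fd hh₁ x u Y, sym_fd hh₂ x u Y, sym_fd hh₁ x u v, sym_fd hh₂ x u v] at c2
  rw [sym_fd hh₁ x v Y, sym_fd hh₂ x v Y] at c3
  rw [sym_fd hf x u X, sym_fd hf x v X, sym_fd hg x u X, sym_fd hg x v X, k1]
  linear_combination -c1 - c2 - c3
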